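/- arXiv:2408.02080 — 6 statements merged into one kernel-verified Lean document; each statement's English description precedes it below -/
import Mathlib

section
/- Let n ≥ 1 and let R be an algebraic Kähler curvature tensor on ℂⁿ, with holomorphic sectional curvature function H and scalar curvature s. Then the average of H over the unit sphere satisfies ∫_{S^{2n−1}} H(ξ) dσ(ξ) = (2s / (n(n+1))) · Vol(S^{2n−1}); equivalently, 2s = (n(n+1) / Vol(S^{2n−1})) · ∫_{S^{2n−1}} H(ξ) dσ(ξ). (Here H(ξ) and s are real numbers by the hermitian symmetry of R.) -/
open MeasureTheory

noncomputable instance (n : ℕ) : MeasurableSpace (EuclideanSpace ℂ (Fin n)) := borel _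
instance (n : ℕ) : BorelSpace (EuclideanSpace ℂ (Fin n)) := ⟨rfl⟩

/-- An algebraic Kähler curvature tensor on `ℂⁿ`: `ℂ`-linear in the 1st and 3rd arguments,
conjugate-linear in the 2nd and 4th arguments, with the symmetries
`R(X,Y,Z,W) = R(Z,Y,X,W) = R(X,W,Z,Y)` and `conj (R(X,Y,Z,W)) = R(Y,X,W,Z)`.
This models the curvature tensor `R(X, Ȳ, Z, W̄)` of a Kähler metric at a point. -/
structure IsKahlerCurvatureTensor {n : ℕ}
    (R : EuclideanSpace ℂ (Fin n) → EuclideanSpace ℂ (Fin n) →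
         EuclideanSpace ℂ (Fin n) → EuclideanSpace ℂ (Fin n) → ℂ) : Prop where
  map_add_fst : ∀ X X' Y Z W, R (X + X') Y Z W = R X Y Z W + R X' Y Z W
  map_smul_fst : ∀ (c : ℂ) X Y Z W, R (c • X) Y Z W = c * R X Y Z W
  map_add_snd : ∀ X Y Y' Z W, R X (Y + Y') Z W = R X Y Z W + R X Y' Z W
  map_smul_snd : ∀ (c : ℂ) X Y Z W, R X (c • Y) Z W = (starRingEnd ℂ) c * R X Y Z W
  map_add_trd : ∀ X Y Z Z' W, R X Y (Z + Z') W = R X Y Z W + R X Y Z' W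
  map_smul_trd : ∀ (c : ℂ) X Y Z W, R X Y (c • Z) W = c * R X Y Z W
  map_add_fth : ∀ X Y Z W W', R X Y Z (W + W') = R X Y Z W + R X Y Z W'
  map_smul_fth : ∀ (c : ℂ) X Y Z W, R X Y Z (c • W) = (starRingEnd ℂ) c * R X Y Z W
  symm_fst_trd : ∀ X Y Z W, R X Y Z W = R Z Y X W
  symm_snd_fth : ∀ X Y Z W, R X Y Z W = R X W Z Y
  conj_symm : ∀ X Y Z W, (starRingEnd ℂ) (R X Y Z W) = R Y X W Z

open Complex ComplexConjugate

theorem IsometryEquiv.preimage_sphere_zero {E : Type*} [NormedAddCommGroup E] {g : E ≃ᵢ E}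
    (hg : g 0 = 0) (r : ℝ) : g ⁻¹' Metric.sphere 0 r = Metric.sphere 0 r := by
  rw [g.preimage_sphere, (g.symm_apply_eq).2 hg.symm]

theorem integral_sphere_comp_isometryEquiv {E F : Type*} [NormedAddCommGroup E]
    [MeasurableSpace E] [BorelSpace E] [NormedAddCommGroup F] [NormedSpace ℝ F]
    {g : E ≃ᵢ E} (hg : g 0 = 0) (δ r : ℝ) (f : E → F) :
    ∫ ξ in Metric.sphere (0 : E) r, f (g ξ) ∂μH[δ] =
      ∫ ξ in Metric.sphere (0 : E) r, f ξ ∂μH[δ] := by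
  have := (g.measurePreserving_hausdorffMeasure δ).setIntegral_preimage_emb
    g.toHomeomorph.measurableEmbedding f (Metric.sphere 0 r)
  rwa [IsometryEquiv.preimage_sphere_zero hg] at this

/-- If the sphere has infinite Hausdorff measure, then by homogeneity every relatively open subset
of it does, so that a continuous function is integrable on it only if it vanishes there. -/
theorem integral_sphere_eq_zero_of_measure_eq_top {E : Type*} [NormedAddCommGroup E]
    [InnerProductSpace ℝ E] [FiniteDimensional ℝ E] [MeasurableSpace E] [BorelSpace E]
    {δ r : ℝ} (htop : μH[δ] (Metric.sphere (0 : E) r) = ⊤) {f : E → ℝ} (hf : Continuous f) :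
    ∫ ξ in Metric.sphere (0 : E) r, f ξ ∂μH[δ] = 0 := by
  by_cases hInt : IntegrableOn f (Metric.sphere (0 : E) r) μH[δ]
  swap
  · exact integral_undef hInt
  refine setIntegral_eq_zero_of_forall_eq_zero fun y hy => ?_
  by_contra hfy
  have : ProperSpace E := FiniteDimensional.proper ℝ E
  refine ((isCompact_sphere (0 : E) r).measure_lt_top_of_nhdsWithin fun x hx => ?_).ne htop
  set g : E ≃ₗᵢ[ℝ] E := (ℝ ∙ (x - y))ᗮ.reflection
  have hgx : g x = y := Submodule.reflection_sub (by simp_all)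
  set U : Set E := {z | ‖f y‖ / 2 < ‖f z‖}
  have hU : IsOpen U := isOpen_lt continuous_const hf.norm
  have hpos : 0 < ‖f y‖ := norm_pos_iff.2 hfy
  have hxU : g ⁻¹' U ∈ nhds x :=
    (hU.preimage g.continuous).mem_nhds (by simpa [hgx, U] using hpos)
  refine ⟨g ⁻¹' U ∩ Metric.sphere 0 r,
    Filter.inter_mem (mem_nhdsWithin_of_mem_nhds hxU) self_mem_nhdsWithin, ?_⟩
  have hlt := hInt.measure_norm_gt_lt_top (half_pos hpos)
  rw [Measure.restrict_apply hU.measurableSet] at hlt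
  rw [← IsometryEquiv.preimage_sphere_zero (g := g.toIsometryEquiv) (map_zero g) r]
  have := (g.toIsometryEquiv.measurePreserving_hausdorffMeasure δ).measure_preimage_equiv
    (f := g.toIsometryEquiv.toHomeomorph.toMeasurableEquiv) (U ∩ Metric.sphere 0 r)
  exact this.trans_lt hlt

namespace EuclideanSpace

variable {n : ℕ}

/-- The moment `∫ ξ_a conj(ξ_b) ξ_c conj(ξ_d)` over the unit sphere of `ℂⁿ`. -/
noncomputable def sphereMoment (δ : ℝ) (a b c d : Fin n) : ℂ :=
  ∫ ξ in Metric.sphere (0 : EuclideanSpace ℂ (Fin n)) 1, ξ a * conj (ξ b) * ξ c * conj (ξ d) ∂μH[δ]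

theorem integrableOn_sphere {δ : ℝ}
    (hfin : μH[δ] (Metric.sphere (0 : EuclideanSpace ℂ (Fin n)) 1) ≠ ⊤)
    {f : EuclideanSpace ℂ (Fin n) → ℂ} (hf : Continuous f) :
    IntegrableOn f (Metric.sphere 0 1) μH[δ] :=
  hf.continuousOn.integrableOn_of_subset_isCompact
    (isCompact_sphere _ _) Metric.isClosed_sphere.measurableSet subset_rfl hfin

theorem sphereMoment_eq_zero_of_phase (δ : ℝ) {a b c d : Fin n} (j : Fin n)
    (hj : (if a = j then I else 1) * conj (if b = j then I else 1) * (if c = j then I else 1) *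
      conj (if d = j then I else 1) ≠ 1) : sphereMoment δ a b c d = 0 := by
  obtain ⟨z, hz⟩ : ∃ z : Circle, (z : ℂ) = I := ⟨⟨I, mem_sphere_zero_iff_norm.2 norm_I⟩, rfl⟩
  let g : EuclideanSpace ℂ (Fin n) ≃ₗᵢ[ℝ] EuclideanSpace ℂ (Fin n) :=
    LinearIsometryEquiv.piLpCongrRight 2 fun i => rotation (if i = j then z else 1)
  have hg : ∀ ξ i, g ξ i = (if i = j then I else 1) * ξ i := by
    intro ξ i
    simp only [g, LinearIsometryEquiv.piLpCongrRight_apply, rotation_apply]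
    by_cases hij : i = j
    · rw [if_pos hij, if_pos hij, hz]
    · rw [if_neg hij, if_neg hij, Circle.coe_one]
  have h := integral_sphere_comp_isometryEquiv (g := g.toIsometryEquiv) (map_zero g) δ 1
    fun ξ => ξ a * conj (ξ b) * ξ c * conj (ξ d)
  change _ = sphereMoment δ a b c d at h
  refine (mul_left_eq_self₀.1 (Eq.trans ?_ h)).resolve_left hj
  rw [sphereMoment, ← integral_const_mul]
  congr 1
  ext ξ
  simp only [LinearIsometryEquiv.coe_toIsometryEquiv, hg, map_mul]
  ring

theorem sphereMoment_eq_zero (δ : ℝ) {a b c d : Fin n} (h₁ : ¬ (b = a ∧ d = c))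
    (h₂ : ¬ (d = a ∧ b = c)) : sphereMoment δ a b c d = 0 := by
  have hI : (-1 : ℂ) ≠ 1 := by norm_num
  have hI' : I ≠ 1 := fun h => by simpa using congrArg im h
  by_cases hab : b = a
  · subst hab
    refine sphereMoment_eq_zero_of_phase δ c ?_
    have : d ≠ c := by tauto
    by_cases hac : b = c <;> simp_all
  by_cases had : d = a
  · subst had
    refine sphereMoment_eq_zero_of_phase δ c ?_
    have : b ≠ c := by tauto
    by_cases hac : d = c <;> simp_all
  refine sphereMoment_eq_zero_of_phase δ a ?_
  by_cases hca : c = a <;> simp_all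

theorem sphereMoment_eq_ite (δ : ℝ) (a b c d : Fin n) :
    sphereMoment δ a b c d = (if b = a then if d = c then sphereMoment δ a a c c else 0 else 0) +
      (if b = c then if d = a then sphereMoment δ a a c c else 0 else 0) -
      (if b = a then if c = a then if d = a then sphereMoment δ a a a a else 0 else 0 else 0) := by
  by_cases h₁ : b = a ∧ d = c
  · obtain ⟨rfl, rfl⟩ := h₁
    by_cases h : b = d
    · subst h; simp
    · simp [h, Ne.symm h]
  by_cases h₂ : d = a ∧ b = c
  · obtain ⟨rfl, rfl⟩ := h₂
    have h : b ≠ d := by tauto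
    have : sphereMoment δ d b b d = sphereMoment δ d d b b := by
      simp only [sphereMoment]
      congr 1
      ext ξ
      ring
    simp [h, this]
  rw [sphereMoment_eq_zero δ h₁ h₂]
  split_ifs <;> simp_all

theorem integral_sphere_quartic {δ : ℝ}
    (hfin : μH[δ] (Metric.sphere (0 : EuclideanSpace ℂ (Fin n)) 1) ≠ ⊤) (S : Finset (Fin n))
    (K : Fin n → Fin n → Fin n → Fin n → ℂ) :
    ∫ ξ in Metric.sphere (0 : EuclideanSpace ℂ (Fin n)) 1,
        ∑ a ∈ S, ∑ b ∈ S, ∑ c ∈ S, ∑ d ∈ S,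
          K a b c d * (ξ a * conj (ξ b) * ξ c * conj (ξ d)) ∂μH[δ] =
      ∑ a ∈ S, (∑ c ∈ S, (K a a c c + K a c c a) * sphereMoment δ a a c c -
        K a a a a * sphereMoment δ a a a a) := by
  have hInt : ∀ f : EuclideanSpace ℂ (Fin n) → ℂ, Continuous f →
      IntegrableOn f (Metric.sphere 0 1) μH[δ] := fun f hf => integrableOn_sphere hfin hf
  rw [integral_finsetSum _ fun _ _ => hInt _ (by fun_prop)]
  refine Finset.sum_congr rfl fun a ha => ?_
  have : ∀ b ∈ S, ∫ ξ in Metric.sphere (0 : EuclideanSpace ℂ (Fin n)) 1, ∑ c ∈ S, ∑ d ∈ S,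
      K a b c d * (ξ a * conj (ξ b) * ξ c * conj (ξ d)) ∂μH[δ] =
      ∑ c ∈ S, ∑ d ∈ S, K a b c d * sphereMoment δ a b c d := by
    intro b _
    rw [integral_finsetSum _ fun _ _ => hInt _ (by fun_prop)]
    refine Finset.sum_congr rfl fun c _ => ?_
    rw [integral_finsetSum _ fun _ _ => hInt _ (by fun_prop)]
    exact Finset.sum_congr rfl fun d _ => integral_const_mul _ _
  rw [integral_finsetSum _ fun _ _ => hInt _ (by fun_prop), Finset.sum_congr rfl this,
    Finset.sum_comm]
  have : ∀ c ∈ S, ∑ b ∈ S, ∑ d ∈ S, K a b c d * sphereMoment δ a b c d =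
      (K a a c c + K a c c a) * sphereMoment δ a a c c -
        if c = a then K a a a a * sphereMoment δ a a a a else 0 := by
    intro c hc
    rw [Finset.sum_congr rfl fun b _ => Finset.sum_congr rfl fun d _ =>
      congrArg (K a b c d * ·) (sphereMoment_eq_ite δ a b c d)]
    simp only [mul_add, mul_sub, Finset.sum_add_distrib,
      Finset.sum_sub_distrib, mul_ite, mul_zero, Finset.sum_ite_irrel, Finset.sum_const_zero,
      Finset.sum_ite_eq', ha, hc, if_true, add_mul]
    split_ifs with hca <;> simp [hca]
  rw [Finset.sum_congr rfl this, Finset.sum_sub_distrib, Finset.sum_ite_eq' S a, if_pos ha]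

theorem reflection_single_add_single_apply {a c : Fin n} (hac : a ≠ c) (t : ℝ)
    (ξ : EuclideanSpace ℂ (Fin n)) :
    (ℂ ∙ (single a (1 : ℂ) + single c (t : ℂ))).reflection ξ a =
      2 * ((ξ a + t * ξ c) / (1 + t ^ 2)) - ξ a := by
  have hinner : ∀ ζ : EuclideanSpace ℂ (Fin n),
      inner ℂ (single a (1 : ℂ) + single c (t : ℂ)) ζ = ζ a + t * ζ c := by
    intro ζ
    simp [EuclideanSpace.inner_single_left]
  have hnorm := inner_self_eq_norm_sq_to_K (𝕜 := ℂ) (single a (1 : ℂ) + single c (t : ℂ))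
  rw [hinner] at hnorm
  rw [Submodule.reflection_singleton_apply, ← hnorm, hinner]
  simp [hac, hac.symm, sq]

theorem sphereMoment_reflection {δ : ℝ}
    (hfin : μH[δ] (Metric.sphere (0 : EuclideanSpace ℂ (Fin n)) 1) ≠ ⊤) {a c : Fin n} (hac : a ≠ c)
    {p q : ℝ} {g : EuclideanSpace ℂ (Fin n) ≃ₗᵢ[ℂ] EuclideanSpace ℂ (Fin n)}
    (hg : ∀ ξ, g ξ a = p * ξ a + q * ξ c) :
    sphereMoment δ a a a a = p ^ 4 * sphereMoment δ a a a a + q ^ 4 * sphereMoment δ c c c c +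
      4 * p ^ 2 * q ^ 2 * sphereMoment δ a a c c := by
  have h := integral_sphere_comp_isometryEquiv (g := g.toIsometryEquiv) (map_zero g) δ 1
    fun ξ => ξ a * conj (ξ a) * ξ a * conj (ξ a)
  change _ = sphereMoment δ a a a a at h
  let w : Fin n → ℂ := fun i => if i = a then p else q
  have hcomm : sphereMoment δ c c a a = sphereMoment δ a a c c := by
    simp only [sphereMoment]
    congr 1
    ext ξ
    ring
  have h' := integral_sphere_quartic hfin {a, c} fun i j k l => w i * w j * w k * w l
  simp only [Finset.sum_pair hac, w, if_pos, if_neg hac.symm, hcomm] at h'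
  refine h.symm.trans (Eq.trans ?_ (h'.trans ?_))
  · congr 1
    ext ξ
    simp only [LinearIsometryEquiv.coe_toIsometryEquiv, hg, map_mul, map_add, conj_ofReal]
    ring
  · ring

theorem exists_sphereMoment_eq (n : ℕ) {δ : ℝ}
    (hfin : μH[δ] (Metric.sphere (0 : EuclideanSpace ℂ (Fin n)) 1) ≠ ⊤) :
    ∃ κ : ℂ, ∀ a c : Fin n, sphereMoment δ a a c c = if a = c then 2 * κ else κ := by
  obtain _ | m := n
  · exact ⟨0, fun a => a.elim0⟩
  have hswap : ∀ a c : Fin (m + 1), sphereMoment δ a a a a = sphereMoment δ c c c c := by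
    intro a c
    by_cases hac : a = c
    · rw [hac]
    have := sphereMoment_reflection hfin hac (p := 0) (q := 1)
      (g := (ℂ ∙ (single a (1 : ℂ) + single c ((1 : ℝ) : ℂ))).reflection) fun ξ => by
        rw [reflection_single_add_single_apply hac]; push_cast; ring
    simpa using this
  have hoff : ∀ a c : Fin (m + 1), a ≠ c → sphereMoment δ a a a a = 2 * sphereMoment δ a a c c := by
    intro a c hac
    have := sphereMoment_reflection hfin hac (p := -3 / 5) (q := 4 / 5)
      (g := (ℂ ∙ (single a (1 : ℂ) + single c ((2 : ℝ) : ℂ))).reflection) fun ξ => by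
        rw [reflection_single_add_single_apply hac]; push_cast; ring
    rw [← hswap a c] at this
    push_cast at this
    linear_combination (625 / 288) * this
  refine ⟨sphereMoment δ (0 : Fin (m + 1)) 0 0 0 / 2, fun a c => ?_⟩
  split_ifs with h
  · rw [← h, hswap a 0]; ring
  · rw [hswap 0 a, hoff a c h]; ring

theorem sum_sphereMoment (δ : ℝ)
    (hfin : μH[δ] (Metric.sphere (0 : EuclideanSpace ℂ (Fin n)) 1) ≠ ⊤) :
    ∑ a : Fin n, ∑ c : Fin n, sphereMoment δ a a c c =
      ((μH[δ] (Metric.sphere (0 : EuclideanSpace ℂ (Fin n)) 1)).toReal : ℂ) := by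
  have hInt : ∀ f : EuclideanSpace ℂ (Fin n) → ℂ, Continuous f →
      IntegrableOn f (Metric.sphere 0 1) μH[δ] := fun f hf => integrableOn_sphere hfin hf
  have hsum : ∫ ξ in Metric.sphere (0 : EuclideanSpace ℂ (Fin n)) 1,
      ∑ a, ∑ c, ξ a * conj (ξ a) * ξ c * conj (ξ c) ∂μH[δ] =
      ∑ a : Fin n, ∑ c : Fin n, sphereMoment δ a a c c := by
    rw [integral_finsetSum _ fun _ _ => hInt _ (by fun_prop)]
    refine Finset.sum_congr rfl fun a _ => ?_
    exact integral_finsetSum _ fun _ _ => hInt _ (by fun_prop)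
  have : ∀ ξ ∈ Metric.sphere (0 : EuclideanSpace ℂ (Fin n)) 1,
      ∑ a, ∑ c, ξ a * conj (ξ a) * ξ c * conj (ξ c) = 1 := by
    intro ξ hξ
    have hone : ∑ a, ξ a * conj (ξ a) = 1 := by
      have h := EuclideanSpace.norm_sq_eq ξ
      rw [mem_sphere_zero_iff_norm.1 hξ] at h
      simp only [mul_conj, normSq_eq_norm_sq]
      rw [← ofReal_sum, ← h]
      simp
    simp only [mul_assoc, ← Finset.mul_sum]
    simp only [← mul_assoc, ← Finset.sum_mul, hone]
    simp
  rw [← hsum, setIntegral_congr_fun Metric.isClosed_sphere.measurableSet this]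
  simp [Measure.real]

end EuclideanSpace

namespace IsKahlerCurvatureTensor

variable {n : ℕ} {R : EuclideanSpace ℂ (Fin n) → EuclideanSpace ℂ (Fin n) →
  EuclideanSpace ℂ (Fin n) → EuclideanSpace ℂ (Fin n) → ℂ}

theorem apply_self_eq_sum (hR : IsKahlerCurvatureTensor R) (ξ : EuclideanSpace ℂ (Fin n)) :
    R ξ ξ ξ ξ = ∑ a, ∑ b, ∑ c, ∑ d,
      R (EuclideanSpace.single a 1) (EuclideanSpace.single b 1) (EuclideanSpace.single c 1)
        (EuclideanSpace.single d 1) * (ξ a * conj (ξ b) * ξ c * conj (ξ d)) := by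
  have h₁ : ∀ Y Z W, R ξ Y Z W = ∑ a, ξ a * R (EuclideanSpace.single a 1) Y Z W := by
    intro Y Z W
    have h := map_sum (AddMonoidHom.mk' (fun X => R X Y Z W) fun X X' => hR.map_add_fst X X' Y Z W)
      (fun a => ξ a • EuclideanSpace.single a (1 : ℂ)) Finset.univ
    have hξ := (EuclideanSpace.basisFun (Fin n) ℂ).sum_repr ξ
    simp only [EuclideanSpace.basisFun_apply, EuclideanSpace.basisFun_repr] at hξ
    simpa only [hξ, AddMonoidHom.mk'_apply, hR.map_smul_fst] using h
  have h₂ : ∀ X Z W, R X ξ Z W = ∑ a, conj (ξ a) * R X (EuclideanSpace.single a 1) Z W := by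
    intro X Z W
    rw [← Complex.conj_conj (R X ξ Z W), hR.conj_symm, h₁, map_sum]
    simp only [map_mul, hR.conj_symm]
  have h₃ : ∀ X Y W, R X Y ξ W = ∑ a, ξ a * R X Y (EuclideanSpace.single a 1) W := by
    intro X Y W
    rw [hR.symm_fst_trd, h₁]
    simp only [hR.symm_fst_trd X]
  have h₄ : ∀ X Y Z, R X Y Z ξ = ∑ a, conj (ξ a) * R X Y Z (EuclideanSpace.single a 1) := by
    intro X Y Z
    rw [hR.symm_snd_fth, h₂]
    simp only [hR.symm_snd_fth X Y]
  rw [h₁]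
  refine Finset.sum_congr rfl fun a _ => ?_
  rw [h₂, Finset.mul_sum]
  refine Finset.sum_congr rfl fun b _ => ?_
  rw [h₃, Finset.mul_sum, Finset.mul_sum]
  refine Finset.sum_congr rfl fun c _ => ?_
  rw [h₄, Finset.mul_sum, Finset.mul_sum, Finset.mul_sum]
  exact Finset.sum_congr rfl fun d _ => by ring

theorem continuous_apply_self (hR : IsKahlerCurvatureTensor R) :
    Continuous fun ξ => R ξ ξ ξ ξ := by
  rw [funext hR.apply_self_eq_sum]
  fun_prop

end IsKahlerCurvatureTensor

/-- For an algebraic Kähler curvature tensor `R` on `ℂⁿ` (`n ≥ 1`), with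
holomorphic sectional curvature `H(ξ) = R(ξ,ξ,ξ,ξ)` and scalar curvature
`s = Σ_{α,β} R(e_α,e_α,e_β,e_β)`, the average of `H` over the unit sphere `S^{2n-1}`
(with its `(2n-1)`-dimensional Hausdorff surface measure) satisfies
`∫_{S^{2n−1}} H(ξ) dσ(ξ) = (2s / (n(n+1))) ⬝ Vol(S^{2n−1})`. -/
theorem average_holomorphic_sectional_curvature (n : ℕ) (hn : 1 ≤ n)
    (R : EuclideanSpace ℂ (Fin n) → EuclideanSpace ℂ (Fin n) →
         EuclideanSpace ℂ (Fin n) → EuclideanSpace ℂ (Fin n) → ℂ)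
    (hR : IsKahlerCurvatureTensor R)
    (s : ℝ)
    (hs : (s : ℂ) = ∑ α, ∑ β, R (EuclideanSpace.single α (1 : ℂ))
      (EuclideanSpace.single α (1 : ℂ)) (EuclideanSpace.single β (1 : ℂ))
      (EuclideanSpace.single β (1 : ℂ))) :
    (∫ ξ in Metric.sphere (0 : EuclideanSpace ℂ (Fin n)) 1, (R ξ ξ ξ ξ).re ∂ μH[2 * n - 1])
      = (2 * s / (n * (n + 1)))
        * (μH[2 * n - 1] (Metric.sphere (0 : EuclideanSpace ℂ (Fin n)) 1)).toReal := by
  by_cases htop : μH[2 * n - 1] (Metric.sphere (0 : EuclideanSpace ℂ (Fin n)) 1) = ⊤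
  · let := InnerProductSpace.rclikeToReal ℂ (EuclideanSpace ℂ (Fin n))
    rw [htop, ENNReal.toReal_top, mul_zero]
    exact integral_sphere_eq_zero_of_measure_eq_top htop
      (continuous_re.comp hR.continuous_apply_self)
  obtain ⟨κ, hκ⟩ := EuclideanSpace.exists_sphereMoment_eq n htop
  have hvol := EuclideanSpace.sum_sphereMoment _ htop
  have hH := EuclideanSpace.integral_sphere_quartic htop Finset.univ fun a b c d =>
    R (EuclideanSpace.single a 1) (EuclideanSpace.single b 1) (EuclideanSpace.single c 1)
      (EuclideanSpace.single d 1)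
  simp only [← hR.apply_self_eq_sum] at hH
  have hn0 : (n : ℂ) ≠ 0 := by exact_mod_cast (by lia : n ≠ 0)
  have hn1 : (n : ℂ) + 1 ≠ 0 := by exact_mod_cast n.succ_ne_zero
  have hvol' : (n : ℂ) * (n + 1) * κ =
      ((μH[2 * n - 1] (Metric.sphere (0 : EuclideanSpace ℂ (Fin n)) 1)).toReal : ℂ) := by
    rw [← hvol]
    have : ∀ a c : Fin n, (if a = c then 2 * κ else κ) = κ + if a = c then κ else 0 := by
      intro a c
      split_ifs <;> ring
    simp [hκ, this, Finset.sum_add_distrib]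
    ring
  have hs' : ∫ ξ in Metric.sphere (0 : EuclideanSpace ℂ (Fin n)) 1, R ξ ξ ξ ξ ∂μH[2 * n - 1] =
      2 * κ * s := by
    rw [hH, hs, Finset.mul_sum]
    refine Finset.sum_congr rfl fun a _ => ?_
    rw [sub_eq_iff_eq_add, Finset.mul_sum, hκ a a, if_pos rfl,
      ← Finset.sum_erase_add _ _ (Finset.mem_univ a),
      ← Finset.sum_erase_add Finset.univ (fun c => 2 * κ * _) (Finset.mem_univ a), hκ a a,
      if_pos rfl, add_assoc]
    congr 1
    · refine Finset.sum_congr rfl fun c hc => ?_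
      rw [hκ, if_neg (Finset.ne_of_mem_erase hc).symm, hR.symm_snd_fth (EuclideanSpace.single a 1)
        (EuclideanSpace.single c 1)]
      ring
    · ring
  have hre := integral_re (𝕜 := ℂ) (EuclideanSpace.integrableOn_sphere htop hR.continuous_apply_self)
  simp only [RCLike.re_eq_complex_re] at hre
  rw [hre, hs']
  have : (2 * κ * s : ℂ) = ((2 * s / (n * (n + 1)) *
      (μH[2 * n - 1] (Metric.sphere (0 : EuclideanSpace ℂ (Fin n)) 1)).toReal : ℝ) : ℂ) := by
    rw [ofReal_mul, ← hvol']
    push_cast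
    field_simp
  rw [this, ofReal_re]
end

section
/- Let n ≥ 1 and let R be an algebraic Kähler curvature tensor on ℂⁿ with holomorphic sectional curvature function H. Suppose e₁ ∈ ℂⁿ is a unit vector that minimizes H over the unit sphere, i.e. H(e₁) ≤ H(X) for every unit vector X ∈ ℂⁿ. Then for every unit vector W ∈ ℂⁿ one has 2·R(e₁, e₁, W, W) ≥ (1 + |⟨W, e₁⟩|²) · R(e₁, e₁, e₁, e₁) (an inequality of real numbers). -/
open scoped InnerProductSpace

lemma quartic_coeff_of_nonneg {b c d f : ℝ}
    (h : ∀ t : ℝ, 0 ≤ b * t + c * t ^ 2 + d * t ^ 3 + f * t ^ 4) : b = 0 ∧ 0 ≤ c := by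
  constructor
  · have hd : HasDerivAt (fun t : ℝ => b * t + c * t ^ 2 + d * t ^ 3 + f * t ^ 4) b 0 := by
      have := ((((hasDerivAt_id (0 : ℝ)).const_mul b).add
        ((hasDerivAt_pow 2 (0 : ℝ)).const_mul c)).add
        ((hasDerivAt_pow 3 (0 : ℝ)).const_mul d)).add ((hasDerivAt_pow 4 (0 : ℝ)).const_mul f)
      exact this.congr_deriv (by simp)
    refine IsLocalMin.hasDerivAt_eq_zero (Filter.Eventually.of_forall fun t => ?_) hd
    simpa using h t
  · by_contra! hc
    have hf : 0 < |f| + 1 := by positivity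
    set s := Real.sqrt (-c / (2 * (|f| + 1))) with hs
    have hpos : 0 < -c / (2 * (|f| + 1)) := div_pos (by linarith) (by linarith)
    have hsq : s ^ 2 = -c / (2 * (|f| + 1)) := Real.sq_sqrt hpos.le
    have hsc : s ^ 2 * (2 * (|f| + 1)) = -c := by rw [hsq]; field_simp
    have hs2 : 0 < s ^ 2 := hsq ▸ hpos
    have hsum : 0 ≤ s ^ 2 * (c + f * s ^ 2) := by linarith [h s, h (-s)]
    have hfac : 0 ≤ c + f * s ^ 2 := nonneg_of_mul_nonneg_right hsum hs2
    nlinarith [mul_le_mul_of_nonneg_right (le_abs_self f) hs2.le]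

namespace IsKahlerCurvatureTensor

variable {n : ℕ}
  {R : EuclideanSpace ℂ (Fin n) → EuclideanSpace ℂ (Fin n) →
    EuclideanSpace ℂ (Fin n) → EuclideanSpace ℂ (Fin n) → ℂ}

lemma re_smul_self (hR : IsKahlerCurvatureTensor R) (r : ℝ) (X : EuclideanSpace ℂ (Fin n)) :
    (R ((r : ℂ) • X) ((r : ℂ) • X) ((r : ℂ) • X) ((r : ℂ) • X)).re
      = r ^ 4 * (R X X X X).re := by
  simp only [hR.map_smul_fst, hR.map_smul_snd, hR.map_smul_trd, hR.map_smul_fth,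
    Complex.conj_ofReal, Complex.re_ofReal_mul]
  ring

lemma mul_norm_pow_four_le (hR : IsKahlerCurvatureTensor R) {h : ℝ}
    (hmin : ∀ X : EuclideanSpace ℂ (Fin n), ‖X‖ = 1 → h ≤ (R X X X X).re)
    (X : EuclideanSpace ℂ (Fin n)) : h * ‖X‖ ^ 4 ≤ (R X X X X).re := by
  rcases eq_or_ne X 0 with rfl | hX
  · have := hR.re_smul_self 0 (0 : EuclideanSpace ℂ (Fin n))
    simp only [smul_zero] at this
    rw [this, norm_zero]
    simp
  · have hX' : ‖X‖ ≠ 0 := norm_ne_zero_iff.mpr hX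
    have hunit : ‖((‖X‖⁻¹ : ℝ) : ℂ) • X‖ = 1 := by
      rw [norm_smul, Complex.norm_real, norm_inv, norm_norm, inv_mul_cancel₀ hX']
    have key := hmin _ hunit
    rw [hR.re_smul_self] at key
    rwa [inv_pow, ← div_eq_inv_mul, le_div_iff₀ (by positivity)] at key

lemma re_add_smul_self (hR : IsKahlerCurvatureTensor R) (e V : EuclideanSpace ℂ (Fin n))
    (t : ℝ) :
    (R (e + (t : ℂ) • V) (e + (t : ℂ) • V) (e + (t : ℂ) • V) (e + (t : ℂ) • V)).re
      = (R e e e e).re + 4 * (R e e e V).re * t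
        + (4 * (R e e V V).re + 2 * (R e V e V).re) * t ^ 2
        + 4 * (R V V V e).re * t ^ 3 + (R V V V V).re * t ^ 4 := by
  have conj_re : ∀ X Y Z W, (R Y X W Z).re = (R X Y Z W).re := fun X Y Z W => by
    rw [← hR.conj_symm, Complex.conj_re]
  simp only [hR.map_add_fst, hR.map_add_snd, hR.map_add_trd, hR.map_add_fth,
    hR.map_smul_fst, hR.map_smul_snd, hR.map_smul_trd, hR.map_smul_fth,
    Complex.conj_ofReal, Complex.add_re, Complex.re_ofReal_mul]
  rw [hR.symm_snd_fth e V e e, hR.symm_fst_trd V e e e, conj_re e e e V,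
    hR.symm_snd_fth V V e e, hR.symm_fst_trd V e e V, hR.symm_snd_fth e V V e,
    conj_re e V e V, hR.symm_fst_trd e V V V, conj_re V V V e, hR.symm_snd_fth V e V V]
  ring

/-- The first and second variation of the holomorphic sectional curvature at a minimizer, in a
direction orthogonal to it. -/
lemma variation_of_minimizer (hR : IsKahlerCurvatureTensor R) {e : EuclideanSpace ℂ (Fin n)}
    (he : ‖e‖ = 1)
    (hmin : ∀ X : EuclideanSpace ℂ (Fin n), ‖X‖ = 1 → (R e e e e).re ≤ (R X X X X).re)
    {V : EuclideanSpace ℂ (Fin n)} (hV : ⟪e, V⟫_ℂ = 0) :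
    (R e e e V).re = 0 ∧
      (R e e e e).re * ‖V‖ ^ 2 ≤ 2 * (R e e V V).re + (R e V e V).re := by
  have hnorm : ∀ t : ℝ, ‖e + (t : ℂ) • V‖ ^ 2 = 1 + t ^ 2 * ‖V‖ ^ 2 := fun t => by
    have := norm_add_sq_eq_norm_sq_add_norm_sq_of_inner_eq_zero (𝕜 := ℂ) e ((t : ℂ) • V)
      (by rw [inner_smul_right, hV, mul_zero])
    rw [norm_smul, Complex.norm_real, Real.norm_eq_abs, he] at this
    rw [← sq_abs t]
    linarith
  obtain ⟨h₁, h₂⟩ := quartic_coeff_of_nonneg (b := 4 * (R e e e V).re)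
    (c := 4 * (R e e V V).re + 2 * (R e V e V).re - 2 * ((R e e e e).re * ‖V‖ ^ 2))
    (d := 4 * (R V V V e).re) (f := (R V V V V).re - (R e e e e).re * ‖V‖ ^ 4) fun t => by
      have := hR.mul_norm_pow_four_le hmin (e + (t : ℂ) • V)
      rw [hR.re_add_smul_self, show ‖e + (t : ℂ) • V‖ ^ 4 = (‖e + (t : ℂ) • V‖ ^ 2) ^ 2 by ring,
        hnorm] at this
      linarith
  exact ⟨by linarith, by linarith⟩

end IsKahlerCurvatureTensor

/-- **Yang's RC-positivity lemma.** If `e₁` is a unit vector minimizing the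
holomorphic sectional curvature `H(X) = R(X,X,X,X)` of an algebraic Kähler curvature tensor
`R` on `ℂⁿ` over the unit sphere, then for every unit vector `W`,
`2 ⬝ R(e₁,e₁,W,W) ≥ (1 + |⟨W,e₁⟩|²) ⬝ R(e₁,e₁,e₁,e₁)` (as real numbers). -/
theorem minimizer_bisectional_lower_bound (n : ℕ) (hn : 1 ≤ n)
    (R : EuclideanSpace ℂ (Fin n) → EuclideanSpace ℂ (Fin n) →
         EuclideanSpace ℂ (Fin n) → EuclideanSpace ℂ (Fin n) → ℂ)
    (hR : IsKahlerCurvatureTensor R)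
    (e₁ : EuclideanSpace ℂ (Fin n)) (he₁ : ‖e₁‖ = 1)
    (hmin : ∀ X : EuclideanSpace ℂ (Fin n), ‖X‖ = 1 → (R e₁ e₁ e₁ e₁).re ≤ (R X X X X).re)
    (W : EuclideanSpace ℂ (Fin n)) (hW : ‖W‖ = 1) :
    2 * (R e₁ e₁ W W).re ≥ (1 + ‖(⟪e₁, W⟫_ℂ : ℂ)‖ ^ 2) * (R e₁ e₁ e₁ e₁).re := by
  have variation {V : EuclideanSpace ℂ (Fin n)} := hR.variation_of_minimizer he₁ hmin (V := V)
  obtain ⟨a, V, ha, hV, rfl⟩ : ∃ (a : ℂ) (V : EuclideanSpace ℂ (Fin n)),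
      a = ⟪e₁, W⟫_ℂ ∧ ⟪e₁, V⟫_ℂ = 0 ∧ W = a • e₁ + V := by
    refine ⟨⟪e₁, W⟫_ℂ, W - ⟪e₁, W⟫_ℂ • e₁, rfl, ?_, by abel⟩
    rw [inner_sub_right, inner_smul_right, inner_self_eq_norm_sq_to_K, he₁]
    simp
  have hnorm : ‖a‖ ^ 2 + ‖V‖ ^ 2 = 1 := by
    have := norm_add_sq_eq_norm_sq_add_norm_sq_of_inner_eq_zero (𝕜 := ℂ) (a • e₁) V
      (by rw [inner_smul_left, hV, mul_zero])
    rw [hW, norm_smul, he₁] at this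
    linarith
  obtain ⟨hre, hvar⟩ := variation hV
  obtain ⟨him, hvarI⟩ := variation (V := Complex.I • V)
    (by rw [inner_smul_right, hV, mul_zero])
  simp only [hR.map_smul_trd, hR.map_smul_snd, hR.map_smul_fth, norm_smul] at him hvarI
  simp at him hvarI
  have hzero : R e₁ e₁ e₁ V = 0 := Complex.ext hre him
  have hzero' : R e₁ e₁ V e₁ = 0 := by rw [← hR.conj_symm, hzero, map_zero]
  have hexp : (R e₁ e₁ (a • e₁ + V) (a • e₁ + V)).re
      = ‖a‖ ^ 2 * (R e₁ e₁ e₁ e₁).re + (R e₁ e₁ V V).re := by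
    simp only [hR.map_add_trd, hR.map_add_fth, hR.map_smul_trd, hR.map_smul_fth, hzero, hzero',
      mul_zero, add_zero, zero_add, Complex.add_re]
    rw [← mul_assoc, Complex.mul_conj, Complex.re_ofReal_mul, Complex.normSq_eq_norm_sq]
  rw [← ha, hexp]
  have hV2 : ‖V‖ ^ 2 = 1 - ‖a‖ ^ 2 := by linarith
  rw [hV2] at hvar hvarI
  linarith
end

section
/- Let n ≥ 1 and let R be an algebraic Kähler curvature tensor on ℂⁿ with holomorphic sectional curvature function H. Suppose e₁ ∈ ℂⁿ is a unit vector that minimizes H over the unit sphere and that H(e₁) = R(e₁,e₁,e₁,e₁) = 2. Then for every unit vector W ∈ ℂⁿ one has R(e₁, e₁, W, W) ≥ 1 + |⟨W, e₁⟩|² (an inequality of real numbers). -/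
open scoped InnerProductSpace

/-- The sum of the holomorphic sectional curvature over the four vectors `X + iᵏ V` only retains
the terms of equal degree in `V` and its conjugate. -/
lemma IsKahlerCurvatureTensor.sum_four_phases {n : ℕ}
    {R : EuclideanSpace ℂ (Fin n) → EuclideanSpace ℂ (Fin n) →
         EuclideanSpace ℂ (Fin n) → EuclideanSpace ℂ (Fin n) → ℂ}
    (hR : IsKahlerCurvatureTensor R) (X V : EuclideanSpace ℂ (Fin n)) (s : ℝ) :
    let H := fun c : ℂ => R (X + c • V) (X + c • V) (X + c • V) (X + c • V)
    H s + H (-s) + H (Complex.I * s) + H (-(Complex.I * s)) =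
      4 * (R X X X X + 4 * s ^ 2 * R X X V V + s ^ 4 * R V V V V) := by
  have h₁ : R V X X V = R X X V V := hR.symm_fst_trd ..
  have h₂ : R X V V X = R X X V V := hR.symm_snd_fth ..
  have h₃ : R V V X X = R X X V V := by rw [hR.symm_fst_trd, h₂]
  simp only [hR.map_add_fst, hR.map_add_snd, hR.map_add_trd, hR.map_add_fth, hR.map_smul_fst,
    hR.map_smul_snd, hR.map_smul_trd, hR.map_smul_fth, h₁, h₂, h₃, map_neg, map_mul,
    Complex.conj_I, Complex.conj_ofReal]
  have hI : Complex.I ^ 2 = -1 := Complex.I_sq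
  have hI4 : Complex.I ^ 4 = 1 := Complex.I_pow_four
  ring_nf
  simp only [hI, hI4]
  ring

/-- A holomorphic sectional curvature bounded below by `c` on the unit sphere satisfies the
corresponding homogeneous bound on all vectors. -/
lemma IsKahlerCurvatureTensor.mul_norm_pow_four_le_s4 {n : ℕ}
    {R : EuclideanSpace ℂ (Fin n) → EuclideanSpace ℂ (Fin n) →
         EuclideanSpace ℂ (Fin n) → EuclideanSpace ℂ (Fin n) → ℂ}
    (hR : IsKahlerCurvatureTensor R) {c : ℝ}
    (hc : ∀ X : EuclideanSpace ℂ (Fin n), ‖X‖ = 1 → c ≤ (R X X X X).re)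
    (X : EuclideanSpace ℂ (Fin n)) : c * (‖X‖ ^ 2) ^ 2 ≤ (R X X X X).re := by
  rcases eq_or_ne X 0 with rfl | hX
  · have h := hR.map_smul_fst 0 0 0 0 0
    rw [zero_smul, zero_mul] at h
    simp [h]
  · have hX' : ‖X‖ ≠ 0 := norm_ne_zero_iff.mpr hX
    obtain ⟨Y, hY, hXY⟩ : ∃ Y : EuclideanSpace ℂ (Fin n), ‖Y‖ = 1 ∧ X = (‖X‖ : ℂ) • Y := by
      refine ⟨((‖X‖ : ℂ))⁻¹ • X, ?_, ?_⟩
      · simp [norm_smul, hX']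
      · rw [smul_inv_smul₀ (by exact_mod_cast hX')]
    have h : R X X X X = ((‖X‖ ^ 4 : ℝ) : ℂ) * R Y Y Y Y := by
      generalize ‖X‖ = r at hXY
      subst hXY
      simp only [hR.map_smul_fst, hR.map_smul_snd, hR.map_smul_trd, hR.map_smul_fth,
        Complex.conj_ofReal]
      push_cast
      ring
    rw [h, Complex.re_ofReal_mul]
    nlinarith [mul_le_mul_of_nonneg_left (hc Y hY) (by positivity : 0 ≤ ‖X‖ ^ 4)]

/-- Squared norm of `X + c • V` for unit vectors `X` and `V`. -/
lemma norm_add_smul_sq_of_norm_eq_one {E : Type*} [NormedAddCommGroup E] [InnerProductSpace ℂ E]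
    {X V : E} (hX : ‖X‖ = 1) (hV : ‖V‖ = 1) (c : ℂ) :
    ‖X + c • V‖ ^ 2 = 1 + 2 * (c * ⟪X, V⟫_ℂ).re + ‖c‖ ^ 2 := by
  rw [@norm_add_sq ℂ, inner_smul_right, norm_smul, hX, hV]
  simp

/-- If `e₁` is a unit vector minimizing the holomorphic sectional curvature
`H(X) = R(X,X,X,X)` of an algebraic Kähler curvature tensor `R` on `ℂⁿ` over the unit sphere,
and `H(e₁) = 2`, then for every unit vector `W`,
`R(e₁,e₁,W,W) ≥ 1 + |⟨W,e₁⟩|²` (as real numbers). -/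
theorem minimizer_bisectional_lower_bound_two (n : ℕ) (hn : 1 ≤ n)
    (R : EuclideanSpace ℂ (Fin n) → EuclideanSpace ℂ (Fin n) →
         EuclideanSpace ℂ (Fin n) → EuclideanSpace ℂ (Fin n) → ℂ)
    (hR : IsKahlerCurvatureTensor R)
    (e₁ : EuclideanSpace ℂ (Fin n)) (he₁ : ‖e₁‖ = 1)
    (hmin : ∀ X : EuclideanSpace ℂ (Fin n), ‖X‖ = 1 → (R e₁ e₁ e₁ e₁).re ≤ (R X X X X).re)
    (htwo : R e₁ e₁ e₁ e₁ = 2)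
    (W : EuclideanSpace ℂ (Fin n)) (hW : ‖W‖ = 1) :
    (R e₁ e₁ W W).re ≥ 1 + ‖(⟪e₁, W⟫_ℂ : ℂ)‖ ^ 2 := by
  have hbound := hR.mul_norm_pow_four_le_s4 hmin
  simp only [htwo, Complex.re_ofNat] at hbound
  have key (s : ℝ) : 0 ≤ 4 * ((R e₁ e₁ W W).re - (1 + ‖(⟪e₁, W⟫_ℂ : ℂ)‖ ^ 2)) +
      s ^ 2 * ((R W W W W).re - 2) ∨ s = 0 := by
    rcases eq_or_ne s 0 with hs | hs
    · exact Or.inr hs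
    left
    have hsum := congrArg Complex.re (hR.sum_four_phases e₁ W s)
    have hcast : (4 * (R e₁ e₁ e₁ e₁ + 4 * (s : ℂ) ^ 2 * R e₁ e₁ W W + (s : ℂ) ^ 4 * R W W W W)).re
        = 4 * (2 + 4 * s ^ 2 * (R e₁ e₁ W W).re + s ^ 4 * (R W W W W).re) := by
      rw [htwo]
      norm_cast
      simp only [Complex.add_re, Complex.mul_re, Complex.ofReal_re, Complex.ofReal_im]
      simp
    simp only [hcast, Complex.add_re] at hsum
    have b₁ := hbound (e₁ + (s : ℂ) • W)
    have b₂ := hbound (e₁ + (-s : ℂ) • W)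
    have b₃ := hbound (e₁ + (Complex.I * s) • W)
    have b₄ := hbound (e₁ + (-(Complex.I * s)) • W)
    rw [norm_add_smul_sq_of_norm_eq_one he₁ hW] at b₁ b₂ b₃ b₄
    rw [Complex.sq_norm, Complex.normSq_apply]
    simp only [neg_mul, Complex.neg_re, Complex.mul_re, Complex.mul_im, Complex.I_re, Complex.I_im,
      Complex.ofReal_re, Complex.ofReal_im, norm_neg, norm_mul, Complex.norm_I, Complex.norm_real,
      Real.norm_eq_abs, one_mul, sq_abs] at b₁ b₂ b₃ b₄
    have hs2 : 0 < s ^ 2 := by positivity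
    refine nonneg_of_mul_nonneg_right ?_ hs2
    linarith
  by_contra! hlt
  have hd : 0 ≤ (R W W W W).re - 2 := by
    have := hmin W hW
    rw [htwo, Complex.re_ofNat] at this
    linarith
  generalize (R W W W W).re - 2 = d at key hd
  obtain ⟨c, hc⟩ : ∃ c, c = 1 + ‖(⟪e₁, W⟫_ℂ : ℂ)‖ ^ 2 - (R e₁ e₁ W W).re := ⟨_, rfl⟩
  have hc0 : 0 < c := by linarith
  have hpos : 0 < c / (d + 1) := by positivity
  rcases key (√(c / (d + 1))) with h | h
  · rw [Real.sq_sqrt hpos.le] at h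
    have hle : c / (d + 1) * d ≤ c := by
      rw [div_mul_eq_mul_div, div_le_iff₀ (by linarith)]
      nlinarith
    linarith
  · exact (Real.sqrt_pos.mpr hpos).ne' h
end

section
/- Let n ≥ 2 and let R be an algebraic Kähler curvature tensor on ℂⁿ with holomorphic sectional curvature function H. Let a ∈ ℝ and suppose that R has orthogonal holomorphic bisectional curvature bounded below by a, i.e. R(X, X, Y, Y) ≥ a for all unit vectors X, Y ∈ ℂⁿ with ⟨X, Y⟩ = 0. Then for any two orthonormal vectors X, Y ∈ ℂⁿ one has H(X) + H(Y) ≥ 4a. -/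
open scoped InnerProductSpace

namespace IsKahlerCurvatureTensor

variable {n : ℕ}
  {R : EuclideanSpace ℂ (Fin n) → EuclideanSpace ℂ (Fin n) →
       EuclideanSpace ℂ (Fin n) → EuclideanSpace ℂ (Fin n) → ℂ}

/-- The bisectional curvature of the pair `X + Y`, `X - Y`. -/
theorem apply_add_sub (hR : IsKahlerCurvatureTensor R) (X Y : EuclideanSpace ℂ (Fin n)) :
    R (X + Y) (X + Y) (X - Y) (X - Y) =
      R X X X X + R Y Y Y Y - R X Y X Y - R Y X Y X := by
  have hsub : X - Y = X + (-1 : ℂ) • Y := by simp [sub_eq_add_neg]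
  rw [hsub]
  simp only [hR.map_add_fst, hR.map_add_snd, hR.map_add_trd, hR.map_add_fth,
    hR.map_smul_trd, hR.map_smul_fth, map_neg, map_one]
  rw [hR.symm_fst_trd X X Y X, hR.symm_fst_trd X X Y Y, hR.symm_snd_fth Y X X Y,
    hR.symm_snd_fth X X X Y, hR.symm_fst_trd X Y Y Y, hR.symm_snd_fth Y X Y Y,
    hR.symm_fst_trd X Y Y X, hR.symm_snd_fth Y Y X X]
  ring

theorem bisectional_smul (hR : IsKahlerCurvatureTensor R) (r : ℝ)
    (U V : EuclideanSpace ℂ (Fin n)) :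
    R ((r : ℂ) • U) ((r : ℂ) • U) ((r : ℂ) • V) ((r : ℂ) • V) = ((r ^ 4 : ℝ) : ℂ) * R U U V V := by
  simp only [hR.map_smul_fst, hR.map_smul_snd, hR.map_smul_trd, hR.map_smul_fth,
    Complex.conj_ofReal]
  push_cast
  ring

/-- A lower bound on the orthogonal bisectional curvature, applied to the orthonormal pair
`(X + Y) / √2`, `(X - Y) / √2`. -/
theorem four_mul_le_of_orthonormal (hR : IsKahlerCurvatureTensor R) {a : ℝ}
    (hOHBSC : ∀ X Y : EuclideanSpace ℂ (Fin n), ‖X‖ = 1 → ‖Y‖ = 1 →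
      ⟪X, Y⟫_ℂ = 0 → (R X X Y Y).re ≥ a)
    {X Y : EuclideanSpace ℂ (Fin n)} (hX : ‖X‖ = 1) (hY : ‖Y‖ = 1) (hXY : ⟪X, Y⟫_ℂ = 0) :
    4 * a ≤ (R X X X X + R Y Y Y Y - R X Y X Y - R Y X Y X).re := by
  have hYX : ⟪Y, X⟫_ℂ = 0 := inner_eq_zero_symm.mp hXY
  have hs : (√2)⁻¹ ^ 2 = (2 : ℝ)⁻¹ := by rw [inv_pow, Real.sq_sqrt zero_le_two]
  have hnorm : ∀ Z : EuclideanSpace ℂ (Fin n), ‖Z‖ ^ 2 = 2 →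
      ‖(((√2)⁻¹ : ℝ) : ℂ) • Z‖ = 1 := by
    intro Z hZ
    rw [← sq_eq_sq₀ (norm_nonneg _) zero_le_one, norm_smul, mul_pow, hZ, Complex.norm_real,
      Real.norm_eq_abs, sq_abs, hs]
    norm_num
  have hadd : ‖X + Y‖ ^ 2 = 2 := by
    rw [@norm_add_sq ℂ, hXY, hX, hY]
    norm_num
  have hsub : ‖X - Y‖ ^ 2 = 2 := by
    rw [@norm_sub_sq ℂ, hXY, hX, hY]
    norm_num
  have horth : ⟪(((√2)⁻¹ : ℝ) : ℂ) • (X + Y), (((√2)⁻¹ : ℝ) : ℂ) • (X - Y)⟫_ℂ = 0 := by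
    rw [inner_smul_left, inner_smul_right, inner_add_left, inner_sub_right, inner_sub_right,
      hXY, hYX, inner_self_eq_norm_sq_to_K, inner_self_eq_norm_sq_to_K, hX, hY]
    simp
  have h := hOHBSC _ _ (hnorm _ hadd) (hnorm _ hsub) horth
  have h4 : (√2)⁻¹ ^ 4 = (4 : ℝ)⁻¹ := by
    rw [show (√2)⁻¹ ^ 4 = ((√2)⁻¹ ^ 2) ^ 2 by ring, hs]
    norm_num
  rw [hR.bisectional_smul, Complex.re_ofReal_mul, h4, hR.apply_add_sub] at h
  linarith

end IsKahlerCurvatureTensor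

/-- If an algebraic Kähler curvature tensor `R` on `ℂⁿ` (`n ≥ 2`) has
orthogonal holomorphic bisectional curvature bounded below by `a`, i.e.
`R(X,X,Y,Y) ≥ a` for all unit vectors `X ⊥ Y`, then for any two orthonormal vectors `X, Y`
the holomorphic sectional curvatures satisfy `H(X) + H(Y) ≥ 4a`. -/
theorem ohbsc_lower_bound_hsc_sum (n : ℕ) (hn : 2 ≤ n)
    (R : EuclideanSpace ℂ (Fin n) → EuclideanSpace ℂ (Fin n) →
         EuclideanSpace ℂ (Fin n) → EuclideanSpace ℂ (Fin n) → ℂ)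
    (hR : IsKahlerCurvatureTensor R)
    (a : ℝ)
    (hOHBSC : ∀ X Y : EuclideanSpace ℂ (Fin n), ‖X‖ = 1 → ‖Y‖ = 1 →
      ⟪X, Y⟫_ℂ = 0 → (R X X Y Y).re ≥ a)
    (X Y : EuclideanSpace ℂ (Fin n)) (hX : ‖X‖ = 1) (hY : ‖Y‖ = 1)
    (hXY : ⟪X, Y⟫_ℂ = 0) :
    (R X X X X).re + (R Y Y Y Y).re ≥ 4 * a := by
  have h₁ := hR.four_mul_le_of_orthonormal hOHBSC hX hY hXY
  have h₂ := hR.four_mul_le_of_orthonormal hOHBSC hX (Y := Complex.I • Y)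
    (by simp [norm_smul, hY]) (by rw [inner_smul_right, hXY, mul_zero])
  simp only [hR.map_smul_fst, hR.map_smul_snd, hR.map_smul_trd, hR.map_smul_fth,
    Complex.conj_I] at h₂
  simp at h₁ h₂
  linarith
end

section
/- Let n ≥ 2 and let R be an algebraic Kähler curvature tensor on ℂⁿ with scalar curvature s. Let a, b ∈ ℝ and suppose that a ≤ R(X, X, Y, Y) ≤ b for all unit vectors X, Y ∈ ℂⁿ with ⟨X, Y⟩ = 0 (i.e. the orthogonal holomorphic bisectional curvature is pinched between a and b). Then n(n+1)·a ≤ s ≤ n(n+1)·b. -/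
open scoped InnerProductSpace

namespace IsKahlerCurvatureTensor

variable {n : ℕ} {R : EuclideanSpace ℂ (Fin n) → EuclideanSpace ℂ (Fin n) →
  EuclideanSpace ℂ (Fin n) → EuclideanSpace ℂ (Fin n) → ℂ}

/-- The negative of a Kähler curvature tensor is a Kähler curvature tensor. -/
lemma neg (hR : IsKahlerCurvatureTensor R) :
    IsKahlerCurvatureTensor fun X Y Z W => -R X Y Z W where
  map_add_fst X X' Y Z W := by rw [hR.map_add_fst]; ring
  map_smul_fst c X Y Z W := by rw [hR.map_smul_fst]; ring
  map_add_snd X Y Y' Z W := by rw [hR.map_add_snd]; ring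
  map_smul_snd c X Y Z W := by rw [hR.map_smul_snd]; ring
  map_add_trd X Y Z Z' W := by rw [hR.map_add_trd]; ring
  map_smul_trd c X Y Z W := by rw [hR.map_smul_trd]; ring
  map_add_fth X Y Z W W' := by rw [hR.map_add_fth]; ring
  map_smul_fth c X Y Z W := by rw [hR.map_smul_fth]; ring
  symm_fst_trd X Y Z W := by rw [hR.symm_fst_trd]
  symm_snd_fth X Y Z W := by rw [hR.symm_snd_fth]
  conj_symm X Y Z W := by rw [map_neg, hR.conj_symm]

/-- Polarization: averaging the bisectional curvatures of the pairs `X ± Y` and `X ± iY`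
recovers the holomorphic sectional curvatures of `X` and `Y`. -/
lemma polarization (hR : IsKahlerCurvatureTensor R) (X Y : EuclideanSpace ℂ (Fin n)) :
    R (X + (1 : ℂ) • Y) (X + (1 : ℂ) • Y) (X + (-1 : ℂ) • Y) (X + (-1 : ℂ) • Y) +
      R (X + Complex.I • Y) (X + Complex.I • Y) (X + (-Complex.I) • Y) (X + (-Complex.I) • Y) =
    2 * (R X X X X + R Y Y Y Y) := by
  simp only [hR.map_add_fst, hR.map_smul_fst, hR.map_add_snd, hR.map_smul_snd,
    hR.map_add_trd, hR.map_smul_trd, hR.map_add_fth, hR.map_smul_fth, map_neg, map_one,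
    Complex.conj_I]
  rw [hR.symm_fst_trd Y X X X, hR.symm_snd_fth X Y X X, hR.symm_fst_trd Y Y X X,
    hR.symm_snd_fth X Y Y X, hR.symm_fst_trd Y X X Y, hR.symm_fst_trd Y Y X Y,
    hR.symm_snd_fth Y Y Y X]
  ring_nf
  simp only [Complex.I_sq, Complex.I_pow_four]
  ring

/-- Rescaled form of a lower bound on the orthogonal bisectional curvature, evaluated on the
orthogonal pair `X ± cY` of vectors of length `√2`. -/
lemma four_mul_le_of_orthogonal (hR : IsKahlerCurvatureTensor R) {a : ℝ}
    (hlow : ∀ X Y : EuclideanSpace ℂ (Fin n), ‖X‖ = 1 → ‖Y‖ = 1 →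
      ⟪X, Y⟫_ℂ = 0 → a ≤ (R X X Y Y).re)
    {X Y : EuclideanSpace ℂ (Fin n)} (hX : ‖X‖ = 1) (hY : ‖Y‖ = 1) (hXY : ⟪X, Y⟫_ℂ = 0)
    {c : ℂ} (hc : ‖c‖ = 1) :
    4 * a ≤ (R (X + c • Y) (X + c • Y) (X + (-c) • Y) (X + (-c) • Y)).re := by
  have hYX : ⟪Y, X⟫_ℂ = 0 := inner_eq_zero_symm.mp hXY
  have hr : (√2)⁻¹ * (√2)⁻¹ = (1 / 2 : ℝ) := by
    rw [← mul_inv, Real.mul_self_sqrt zero_le_two, one_div]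
  have hnorm : ∀ d : ℂ, ‖d‖ = 1 → ‖(((√2)⁻¹ : ℝ) : ℂ) • (X + d • Y)‖ = 1 := by
    intro d hd
    have hsq : ‖X + d • Y‖ * ‖X + d • Y‖ = 2 := by
      rw [norm_add_sq_eq_norm_sq_add_norm_sq_of_inner_eq_zero X (d • Y)
        (by rw [inner_smul_right, hXY, mul_zero]), norm_smul, hX, hY, hd]
      norm_num
    have hsqrt : ‖X + d • Y‖ = √2 := by
      rw [← hsq, Real.sqrt_mul_self (norm_nonneg _)]
    rw [norm_smul, hsqrt, Complex.norm_real, Real.norm_of_nonneg (by positivity)]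
    exact inv_mul_cancel₀ (by positivity)
  have hcc : (starRingEnd ℂ) c * c = 1 := by
    rw [Complex.conj_mul', hc]; norm_num
  have horth : ⟪X + c • Y, X + (-c) • Y⟫_ℂ = 0 := by
    simp only [inner_add_left, inner_add_right, inner_smul_left, inner_smul_right, hXY, hYX,
      inner_self_eq_norm_sq_to_K, hX, hY]
    simp only [RCLike.ofReal_one]
    linear_combination -hcc
  have h := hlow _ _ (hnorm c hc) (hnorm (-c) (by rw [norm_neg, hc]))
    (by rw [inner_smul_left, inner_smul_right, horth, mul_zero, mul_zero])
  simp only [hR.map_smul_fst, hR.map_smul_snd, hR.map_smul_trd, hR.map_smul_fth,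
    Complex.conj_ofReal, Complex.re_ofReal_mul] at h
  rw [← mul_assoc, ← mul_assoc, ← mul_assoc, hr, mul_assoc (1 / 2 : ℝ), hr] at h
  linarith

/-- A lower bound on the orthogonal bisectional curvature bounds the sum of the holomorphic
sectional curvatures of two orthonormal vectors. -/
lemma four_mul_le_add_of_orthonormal (hR : IsKahlerCurvatureTensor R) {a : ℝ}
    (hlow : ∀ X Y : EuclideanSpace ℂ (Fin n), ‖X‖ = 1 → ‖Y‖ = 1 →
      ⟪X, Y⟫_ℂ = 0 → a ≤ (R X X Y Y).re)
    {X Y : EuclideanSpace ℂ (Fin n)} (hX : ‖X‖ = 1) (hY : ‖Y‖ = 1) (hXY : ⟪X, Y⟫_ℂ = 0) :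
    4 * a ≤ (R X X X X).re + (R Y Y Y Y).re := by
  have h₁ := hR.four_mul_le_of_orthogonal hlow hX hY hXY (c := 1) norm_one
  have h₂ := hR.four_mul_le_of_orthogonal hlow hX hY hXY Complex.norm_I
  have h := congrArg Complex.re (hR.polarization X Y)
  rw [Complex.add_re, ← Complex.ofReal_ofNat, Complex.re_ofReal_mul, Complex.add_re] at h
  linarith

end IsKahlerCurvatureTensor

/-- Lower bound for the sum of the entries of a square matrix from lower bounds for its
off-diagonal entries and for the sums of two distinct diagonal entries. -/
lemma mul_le_sum_sum_of_offDiag {n : ℕ} (hn : 2 ≤ n) {a : ℝ} (f : Fin n → Fin n → ℝ)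
    (hoff : ∀ i j, i ≠ j → a ≤ f i j) (hdiag : ∀ i j, i ≠ j → 4 * a ≤ f i i + f j j) :
    n * (n + 1) * a ≤ ∑ i, ∑ j, f i j := by
  have hn' : (2 : ℝ) ≤ n := by exact_mod_cast hn
  have h₁ : ∑ i, ∑ j, (4 * a + if i = j then 2 * f i i - 4 * a else 0) ≤
      ∑ i, ∑ j, (f i i + f j j) := by
    refine Finset.sum_le_sum fun i _ => Finset.sum_le_sum fun j _ => ?_
    split_ifs with h
    · subst h; linarith
    · linarith [hdiag i j h]
  have h₂ : ∑ i, ∑ j, (a + if i = j then f i i - a else 0) ≤ ∑ i, ∑ j, f i j := by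
    refine Finset.sum_le_sum fun i _ => Finset.sum_le_sum fun j _ => ?_
    split_ifs with h
    · subst h; linarith
    · linarith [hoff i j h]
  simp only [Finset.sum_add_distrib, Finset.sum_ite_eq, Finset.mem_univ, if_true,
    Finset.sum_sub_distrib, Finset.sum_const, Finset.card_univ, Fintype.card_fin, nsmul_eq_mul,
    ← Finset.mul_sum] at h₁ h₂
  have h₃ : 2 * (n : ℝ) * a ≤ ∑ i, f i i := by
    by_contra! h
    nlinarith
  linarith

/-- The lower bound for the scalar curvature in terms of the orthogonal bisectional curvature. -/
lemma IsKahlerCurvatureTensor.mul_le_scalar {n : ℕ} (hn : 2 ≤ n)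
    {R : EuclideanSpace ℂ (Fin n) → EuclideanSpace ℂ (Fin n) →
      EuclideanSpace ℂ (Fin n) → EuclideanSpace ℂ (Fin n) → ℂ}
    (hR : IsKahlerCurvatureTensor R) {a : ℝ}
    (hlow : ∀ X Y : EuclideanSpace ℂ (Fin n), ‖X‖ = 1 → ‖Y‖ = 1 →
      ⟪X, Y⟫_ℂ = 0 → a ≤ (R X X Y Y).re) {s : ℝ}
    (hs : (s : ℂ) = ∑ α, ∑ β, R (EuclideanSpace.single α (1 : ℂ))
      (EuclideanSpace.single α (1 : ℂ)) (EuclideanSpace.single β (1 : ℂ))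
      (EuclideanSpace.single β (1 : ℂ))) :
    n * (n + 1) * a ≤ s := by
  have hnorm : ∀ i : Fin n, ‖EuclideanSpace.single i (1 : ℂ)‖ = 1 := by simp
  have horth : ∀ i j : Fin n, i ≠ j →
      ⟪EuclideanSpace.single i (1 : ℂ), EuclideanSpace.single j (1 : ℂ)⟫_ℂ = 0 := by
    intro i j hij
    rw [EuclideanSpace.inner_single_left, PiLp.single_apply, if_neg hij, mul_zero]
  rw [← Complex.ofReal_re s, hs]
  simp only [Complex.re_sum]
  exact mul_le_sum_sum_of_offDiag hn _
    (fun i j hij => hlow _ _ (hnorm i) (hnorm j) (horth i j hij))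
    (fun i j hij => hR.four_mul_le_add_of_orthonormal hlow (hnorm i) (hnorm j) (horth i j hij))

/-- If an algebraic Kähler curvature tensor `R` on `ℂⁿ` (`n ≥ 2`) has
orthogonal holomorphic bisectional curvature pinched between `a` and `b`, i.e.
`a ≤ R(X,X,Y,Y) ≤ b` for all unit vectors `X ⊥ Y`, then its scalar curvature
`s = Σ_{α,β} R(e_α,e_α,e_β,e_β)` satisfies `n(n+1)a ≤ s ≤ n(n+1)b`. -/
theorem ohbsc_pinched_scalar_curvature (n : ℕ) (hn : 2 ≤ n)
    (R : EuclideanSpace ℂ (Fin n) → EuclideanSpace ℂ (Fin n) →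
         EuclideanSpace ℂ (Fin n) → EuclideanSpace ℂ (Fin n) → ℂ)
    (hR : IsKahlerCurvatureTensor R)
    (a b : ℝ)
    (hlow : ∀ X Y : EuclideanSpace ℂ (Fin n), ‖X‖ = 1 → ‖Y‖ = 1 →
      ⟪X, Y⟫_ℂ = 0 → a ≤ (R X X Y Y).re)
    (hup : ∀ X Y : EuclideanSpace ℂ (Fin n), ‖X‖ = 1 → ‖Y‖ = 1 →
      ⟪X, Y⟫_ℂ = 0 → (R X X Y Y).re ≤ b)
    (s : ℝ)
    (hs : (s : ℂ) = ∑ α, ∑ β, R (EuclideanSpace.single α (1 : ℂ))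
      (EuclideanSpace.single α (1 : ℂ)) (EuclideanSpace.single β (1 : ℂ))
      (EuclideanSpace.single β (1 : ℂ))) :
    n * (n + 1) * a ≤ s ∧ s ≤ n * (n + 1) * b := by
  refine ⟨hR.mul_le_scalar hn hlow hs, ?_⟩
  have h := hR.neg.mul_le_scalar hn (a := -b) (s := -s)
    (fun X Y hX hY hXY => by
      rw [Complex.neg_re]
      exact neg_le_neg (hup X Y hX hY hXY))
    (by simp only [Complex.ofReal_neg, hs, Finset.sum_neg_distrib])
  linarith
end

section
/- Let n ≥ 1 and let R be an algebraic Kähler curvature tensor on ℂⁿ with holomorphic sectional curvature function H and scalar curvature s. Let c ∈ ℝ and suppose H(X) ≥ c for every unit vector X ∈ ℂⁿ. Then s ≥ n(n+1)·c/2. In particular, if H(X) ≥ 2 for every unit vector X, then s ≥ n(n+1). -/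
namespace IsKahlerCurvatureTensor

variable {n : ℕ}
  {R : EuclideanSpace ℂ (Fin n) → EuclideanSpace ℂ (Fin n) →
    EuclideanSpace ℂ (Fin n) → EuclideanSpace ℂ (Fin n) → ℂ}

theorem pair_symm (hR : IsKahlerCurvatureTensor R) (X Y : EuclideanSpace ℂ (Fin n)) :
    R Y Y X X = R X X Y Y := by
  rw [hR.symm_fst_trd Y Y X X, hR.symm_snd_fth X Y Y X]

/-- Averaging `R(Z,Z,V,V)` over `Z = X + θ Y` with `θ` a fourth root of unity. -/
theorem sum_phase_fst_snd (hR : IsKahlerCurvatureTensor R) (X Y V : EuclideanSpace ℂ (Fin n)) :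
    R (X + (1 : ℂ) • Y) (X + (1 : ℂ) • Y) V V + R (X + (-1 : ℂ) • Y) (X + (-1 : ℂ) • Y) V V
      + R (X + Complex.I • Y) (X + Complex.I • Y) V V
      + R (X + (-Complex.I) • Y) (X + (-Complex.I) • Y) V V
      = 4 * (R X X V V + R Y Y V V) := by
  simp only [hR.map_add_fst, hR.map_smul_fst, hR.map_add_snd, hR.map_smul_snd,
    map_neg, map_one, Complex.conj_I]
  linear_combination (-2 * R Y Y V V) * Complex.I_sq

/-- Averaging `R(Z,Z,Z,Z)` over `Z = X + θ Y` with `θ` a fourth root of unity. -/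
theorem sum_phase_diag (hR : IsKahlerCurvatureTensor R) (X Y : EuclideanSpace ℂ (Fin n)) :
    R (X + (1 : ℂ) • Y) (X + (1 : ℂ) • Y) (X + (1 : ℂ) • Y) (X + (1 : ℂ) • Y)
      + R (X + (-1 : ℂ) • Y) (X + (-1 : ℂ) • Y) (X + (-1 : ℂ) • Y) (X + (-1 : ℂ) • Y)
      + R (X + Complex.I • Y) (X + Complex.I • Y) (X + Complex.I • Y) (X + Complex.I • Y)
      + R (X + (-Complex.I) • Y) (X + (-Complex.I) • Y) (X + (-Complex.I) • Y)
          (X + (-Complex.I) • Y)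
      = 4 * (R X X X X + R Y Y Y Y + 4 * R X X Y Y) := by
  have h₁ : R Y X X Y = R X X Y Y := hR.symm_fst_trd Y X X Y
  have h₂ : R X Y Y X = R X X Y Y := hR.symm_snd_fth X Y Y X
  have h₃ := hR.pair_symm X Y
  simp only [hR.map_add_fst, hR.map_smul_fst, hR.map_add_snd, hR.map_smul_snd,
    hR.map_add_trd, hR.map_smul_trd, hR.map_add_fth, hR.map_smul_fth,
    map_neg, map_one, Complex.conj_I, h₁, h₂, h₃]
  have h4 : Complex.I ^ 4 = 1 := Complex.I_pow_four
  linear_combination (2 * R X Y X Y + 2 * R Y X Y X - 8 * R X X Y Y) * Complex.I_sq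
    + 2 * R Y Y Y Y * h4

theorem le_re_diag (hR : IsKahlerCurvatureTensor R) {c : ℝ}
    (hH : ∀ X : EuclideanSpace ℂ (Fin n), ‖X‖ = 1 → (R X X X X).re ≥ c)
    (X : EuclideanSpace ℂ (Fin n)) : c * (‖X‖ ^ 2) ^ 2 ≤ (R X X X X).re := by
  rcases eq_or_ne X 0 with rfl | hX
  · have h : R 0 0 0 0 = 0 := by simpa using hR.map_smul_fst 0 0 0 0 0
    simp [h]
  · have hX' : ‖X‖ ≠ 0 := norm_ne_zero_iff.mpr hX
    have hXe : X = (‖X‖ : ℂ) • ((‖X‖⁻¹ : ℝ) : ℂ) • X := by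
      rw [smul_smul, ← Complex.ofReal_mul, mul_inv_cancel₀ hX', Complex.ofReal_one, one_smul]
    have hu : ‖((‖X‖⁻¹ : ℝ) : ℂ) • X‖ = 1 := by
      rw [norm_smul, Complex.norm_real, norm_inv, norm_norm, inv_mul_cancel₀ hX']
    set U := ((‖X‖⁻¹ : ℝ) : ℂ) • X
    have hU := hH U hu
    have key : R X X X X = ((‖X‖ ^ 4 : ℝ) : ℂ) * R U U U U := by
      conv_lhs => rw [hXe]
      simp only [hR.map_smul_fst, hR.map_smul_snd, hR.map_smul_trd, hR.map_smul_fth,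
        Complex.conj_ofReal]
      push_cast
      ring
    rw [key, Complex.re_ofReal_mul]
    nlinarith [mul_le_mul_of_nonneg_left hU (by positivity : 0 ≤ ‖X‖ ^ 4)]

/-- The curvature bound averaged over all vectors `X + ∑ α ∈ S, θ α • e α`, where the `θ α` are
fourth roots of unity and `X` is orthogonal to the `e α`. -/
theorem le_re_phase_average (hR : IsKahlerCurvatureTensor R) {c : ℝ}
    (hH : ∀ X : EuclideanSpace ℂ (Fin n), ‖X‖ = 1 → (R X X X X).re ≥ c)
    {e : Fin n → EuclideanSpace ℂ (Fin n)} (he : Orthonormal ℂ e) (S : Finset (Fin n))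
    (X : EuclideanSpace ℂ (Fin n)) (hX : ∀ α ∈ S, inner ℂ X (e α) = 0) :
    c * (‖X‖ ^ 2 + S.card) ^ 2 ≤ (R X X X X + 4 * ∑ α ∈ S, R X X (e α) (e α)
      + 2 * ∑ α ∈ S, ∑ β ∈ S, R (e α) (e α) (e β) (e β)
      - ∑ α ∈ S, R (e α) (e α) (e α) (e α)).re := by
  induction S using Finset.induction_on generalizing X with
  | empty => simpa using hR.le_re_diag hH X
  | insert b S hb ih =>
    have hXb : inner ℂ X (e b) = 0 := hX b (Finset.mem_insert_self b S)
    have step (θ : ℂ) (hθ : ‖θ‖ = 1) := by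
      refine ih (X + θ • e b) fun α hα => ?_
      have hne : b ≠ α := fun h => hb (h ▸ hα)
      rw [inner_add_left, inner_smul_left, hX α (Finset.mem_insert_of_mem hα), he.2 hne]
      simp
    have hnorm (θ : ℂ) (hθ : ‖θ‖ = 1) : ‖X + θ • e b‖ ^ 2 = ‖X‖ ^ 2 + 1 := by
      have h := norm_add_sq_eq_norm_sq_add_norm_sq_of_inner_eq_zero X (θ • e b)
        (by rw [inner_smul_right, hXb, mul_zero] : inner ℂ X (θ • e b) = 0)
      rw [norm_smul, hθ, he.1 b] at h
      nlinarith
    have h1 := step 1 (by simp)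
    have h2 := step (-1) (by simp)
    have h3 := step Complex.I (by simp)
    have h4 := step (-Complex.I) (by simp)
    rw [hnorm _ (by simp)] at h1 h2 h3 h4
    have hsum := Finset.sum_congr rfl fun α (_ : α ∈ S) =>
      hR.sum_phase_fst_snd X (e b) (e α)
    simp only [← Finset.mul_sum, Finset.sum_add_distrib] at hsum
    have hdiag := hR.sum_phase_diag X (e b)
    have hsymm : ∑ α ∈ S, R (e α) (e α) (e b) (e b) = ∑ α ∈ S, R (e b) (e b) (e α) (e α) :=
      Finset.sum_congr rfl fun α _ => hR.pair_symm (e b) (e α)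
    simp only [Finset.sum_insert hb, Finset.card_insert_of_notMem hb, Finset.sum_add_distrib,
      hsymm]
    have hsumre := congrArg Complex.re hsum
    have hdiagre := congrArg Complex.re hdiag
    simp only [Complex.add_re, Complex.sub_re, Complex.mul_re, Complex.re_ofNat,
      Complex.im_ofNat, zero_mul, sub_zero] at h1 h2 h3 h4 hsumre hdiagre ⊢
    push_cast
    linarith

end IsKahlerCurvatureTensor

/-- If the holomorphic sectional curvature `H(X) = R(X,X,X,X)` of an
algebraic Kähler curvature tensor `R` on `ℂⁿ` (`n ≥ 1`) satisfies `H(X) ≥ c` for every unit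
vector `X`, then the scalar curvature `s = Σ_{α,β} R(e_α,e_α,e_β,e_β)` satisfies
`s ≥ n(n+1)c/2`. (In particular `H ≥ 2` implies `s ≥ n(n+1)`.) -/
theorem hsc_lower_bound_scalar_curvature (n : ℕ) (hn : 1 ≤ n)
    (R : EuclideanSpace ℂ (Fin n) → EuclideanSpace ℂ (Fin n) →
         EuclideanSpace ℂ (Fin n) → EuclideanSpace ℂ (Fin n) → ℂ)
    (hR : IsKahlerCurvatureTensor R)
    (c : ℝ)
    (hH : ∀ X : EuclideanSpace ℂ (Fin n), ‖X‖ = 1 → (R X X X X).re ≥ c)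
    (s : ℝ)
    (hs : (s : ℂ) = ∑ α, ∑ β, R (EuclideanSpace.single α (1 : ℂ))
      (EuclideanSpace.single α (1 : ℂ)) (EuclideanSpace.single β (1 : ℂ))
      (EuclideanSpace.single β (1 : ℂ))) :
    s ≥ n * (n + 1) * c / 2 := by
  have he : Orthonormal ℂ fun α : Fin n => EuclideanSpace.single α (1 : ℂ) :=
    EuclideanSpace.orthonormal_single
  have h := hR.le_re_phase_average hH he Finset.univ 0 (by simp)
  have hzero : ∀ Y Z W, R 0 Y Z W = 0 := fun Y Z W => by
    simpa using hR.map_smul_fst 0 0 Y Z W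
  have hdiag : (n : ℝ) * c ≤ (∑ α, R (EuclideanSpace.single α (1 : ℂ))
      (EuclideanSpace.single α (1 : ℂ)) (EuclideanSpace.single α (1 : ℂ))
      (EuclideanSpace.single α (1 : ℂ))).re := by
    rw [Complex.re_sum]
    simpa using Finset.card_nsmul_le_sum Finset.univ _ c fun α _ => hH _ (he.1 α)
  rw [← hs] at h
  simp only [hzero, Finset.sum_const_zero, norm_zero, Finset.card_univ, Fintype.card_fin,
    Complex.add_re, Complex.sub_re, Complex.mul_re, Complex.re_ofNat, Complex.im_ofNat,
    Complex.ofReal_re, Complex.zero_re, zero_mul, mul_zero, sub_zero] at h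
  nlinarith
end
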